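/- Let 𝒰 be a selective ultrafilter on ω and ℋ a stable ordered-union ultrafilter on FIN with 𝒰 ∈ 𝒞₁(ℋ), and let T ⊆ (ω ∪ FIN)^{<ω} be a (𝒰,ℋ)-tree. Then there exists G ∈ [T] such that {G(2i) : i ∈ ω} ∈ 𝒰, {G(2i+1) : i ∈ ω} ∈ FIN^[ω], G(2i+1) <_b G(2j+1) for all i < j < ω, and [{G(2i+1) : i ∈ ω}] ∈ ℋ. -/

import Mathlib

open Set Filter

abbrev FIN : Type := {s : Finset ℕ // s.Nonempty}

def maxF (s : FIN) : ℕ := s.1.max' s.2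

def minF (s : FIN) : ℕ := s.1.min' s.2

/-- `s <_b t` iff `max s < min t`. -/
def blt (s t : FIN) : Prop := maxF s < minF t

/-- An infinite block sequence, presented as its increasing enumeration. -/
def IsBlockFun (X : ℕ → FIN) : Prop := ∀ i j : ℕ, i < j → blt (X i) (X j)

/-- A block sequence of length `n`. -/
def IsBlockSeqN {n : ℕ} (X : Fin n → FIN) : Prop :=
  ∀ i j : Fin n, i < j → blt (X i) (X j)

/-- `[X]` : all unions of finitely many (at least one) members of `X`. -/
def blocks (X : ℕ → FIN) : Set FIN :=
  {s | ∃ F : Finset ℕ, F.Nonempty ∧ s.1 = F.sup fun i => (X i).1}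

def IsOrderedUnion (H : Ultrafilter FIN) : Prop :=
  ∀ A : Set FIN, A ∈ H →
    ∃ X : ℕ → FIN, IsBlockFun X ∧ blocks X ∈ H ∧ blocks X ⊆ A

def IsStableOU (H : Ultrafilter FIN) : Prop :=
  IsOrderedUnion H ∧
    ∀ Xs : ℕ → ℕ → FIN, (∀ n, IsBlockFun (Xs n) ∧ blocks (Xs n) ∈ H) →
      ∃ Y : ℕ → FIN, IsBlockFun Y ∧ blocks Y ∈ H ∧
        ∀ n, ∀ᶠ i in atTop, Y i ∈ blocks (Xs n)

def IsSelective (U : Ultrafilter ℕ) : Prop :=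
  ∀ f : ℕ → ℕ, ∃ A : Set ℕ, A ∈ U ∧
    ((∀ x ∈ A, ∀ y ∈ A, f x = f y) ∨ Set.InjOn f A)

/-- `I(s) = {k : min s ≤ k ≤ max s}`. -/
def Iset (s : FIN) : Set ℕ := Set.Icc (minF s) (maxF s)

/-- `N(X) = ⋃ i, I(X(i))`. -/
def Nset (X : ℕ → FIN) : Set ℕ := ⋃ i, Iset (X i)

/-- Membership in the class `𝒞₀(ℋ)`. -/
def MemC0 (H : Ultrafilter FIN) (U : Ultrafilter ℕ) : Prop :=
  IsSelective U ∧
    ∀ X : ℕ → FIN, IsBlockFun X → blocks X ∈ H →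
      ∃ Y : ℕ → FIN, IsBlockFun Y ∧ blocks Y ∈ H ∧ blocks Y ⊆ blocks X ∧
        Nset Y ∉ U

def RKle (U V : Ultrafilter ℕ) : Prop := ∃ f : ℕ → ℕ, Ultrafilter.map f V = U

def RKequiv (U V : Ultrafilter ℕ) : Prop := RKle U V ∧ RKle V U

/-- Membership in the class `𝒞₁(ℋ)`. -/
def MemC1 (H : Ultrafilter FIN) (U : Ultrafilter ℕ) : Prop :=
  IsSelective U ∧
    ∀ V : Ultrafilter ℕ, IsSelective V → ¬ MemC0 H V → ¬ RKequiv U V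

def initSeg {α : Type _} (f : ℕ → α) (n : ℕ) : List α := (List.range n).map f

def interleave (a : ℕ → ℕ) (b : ℕ → FIN) (m : ℕ) : ℕ ⊕ FIN :=
  if m % 2 = 0 then Sum.inl (a (m / 2)) else Sum.inr (b (m / 2))

/-- Nodes of the tree `𝕋`: a node of length `l` is a sequence whose `k`-th entry
codes a function `𝒫(k) → 2` (coded as a total function `Finset ℕ → Bool`;
only values on subsets of `{0,…,k−1}` matter). -/
abbrev Node : Type := List (Finset ℕ → Bool)

/-- `s⁻ = s \ {max s}`. -/
def sm (s : FIN) : Finset ℕ := s.1.erase (maxF s)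

/-- `A` is `(k,s)`-big. -/
def IsBig (k : ℕ) (s : FIN) (A : Set (Finset ℕ → Bool)) : Prop :=
  ∀ σ : Finset ℕ → Bool, ∃ τ ∈ A, ∀ u ⊆ Finset.range k, σ u = τ (u ∪ sm s)

def succT (T : Set Node) (f : Node) : Set (Finset ℕ → Bool) := {τ | f ++ [τ] ∈ T}

/-- `H_{p,k}`. -/
def Hset (T : Set Node) (k : ℕ) : Set FIN :=
  {s | k ≤ maxF s ∧ ∀ f ∈ T, f.length = maxF s → IsBig k s (succT T f)}

/-- `T` is an `ℋ`-condition, i.e. a member of `ℙ(ℋ)`. -/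
def IsCond (H : Ultrafilter FIN) (T : Set Node) : Prop :=
  (∀ g ∈ T, ∀ n, g.take n ∈ T) ∧ ([] : Node) ∈ T ∧
    (∀ f ∈ T, ∀ n : ℕ, f.length ≤ n → ∃ g ∈ T, f <+: g ∧ n ≤ g.length) ∧
    ∀ k : ℕ, Hset T k ∈ H

/-- `T⟨f⟩`. -/
def Tsub (T : Set Node) (f : Node) : Set Node := {g ∈ T | f <+: g ∨ g <+: f}

/-- The constraint linking consecutive moves of Player I in `Γ^Cond(ℋ)`. -/
def StepOK (H : Ultrafilter FIN) (p : Set Node) (s : FIN) (p' : Set Node) : Prop :=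
  ∃ q : Node → Set Node,
    (∀ e ∈ p, e.length = maxF s + 1 → IsCond H (q e) ∧ q e ⊆ Tsub p e) ∧
    p' = ⋃ e ∈ {e : Node | e ∈ p ∧ e.length = maxF s + 1}, q e


theorem isSelective_map {U : Ultrafilter ℕ} (hU : IsSelective U) (g : ℕ → ℕ) :
    IsSelective (Ultrafilter.map g U) := by
  intro f
  obtain ⟨A, hA, h⟩ := hU (f ∘ g)
  refine ⟨g '' A, ?_, ?_⟩
  · rw [Ultrafilter.mem_map]
    exact Filter.mem_of_superset hA (Set.subset_preimage_image g A)
  · rcases h with h | h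
    · left
      rintro _ ⟨x, hx, rfl⟩ _ ⟨y, hy, rfl⟩
      exact h x hx y hy
    · right
      rintro _ ⟨x, hx, rfl⟩ _ ⟨y, hy, rfl⟩ hxy
      rw [h hx hy hxy]

theorem injOn_of_finite {U : Ultrafilter ℕ} (hU : IsSelective U) (f : ℕ → ℕ)
    (hf : ∀ n, {x | f x = n}.Finite) : ∃ A ∈ U, Set.InjOn f A := by
  obtain ⟨A, hA, h⟩ := hU f
  rcases h with h | h
  · obtain ⟨x, hx⟩ := U.nonempty_of_mem hA
    have hfin : A.Finite := (hf (f x)).subset (fun y hy => h y hy x hx)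
    obtain ⟨y, hy, hyU⟩ := Ultrafilter.eq_pure_of_finite_mem hfin hA
    refine ⟨{y}, ?_, Set.injOn_singleton _ _⟩
    rw [hyU]; exact Ultrafilter.mem_pure.2 rfl
  · exact ⟨A, hA, h⟩

theorem uf_map_inv {α : Type*} (U : Ultrafilter ℕ) (f : ℕ → α) (A : Set ℕ) (hA : A ∈ U)
    (h : Set.InjOn f A) : ∃ g : α → ℕ, Ultrafilter.map g (Ultrafilter.map f U) = U := by
  classical
  refine ⟨Function.invFunOn f A, ?_⟩
  apply Ultrafilter.coe_injective
  rw [Ultrafilter.coe_map, Ultrafilter.coe_map, Filter.map_map]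
  have : (Function.invFunOn f A ∘ f) =ᶠ[(U : Filter ℕ)] id := by
    filter_upwards [hA] with x hx
    exact h.leftInvOn_invFunOn hx
  rw [Filter.map_congr this, Filter.map_id]

theorem ppoint {U : Ultrafilter ℕ} (hU : IsSelective U) (A : ℕ → Set ℕ) (hA : ∀ n, A n ∈ U) :
    ∃ B ∈ U, ∃ f : ℕ → ℕ, ∀ n, ∀ x ∈ B, f n < x → x ∈ A n := by
  classical
  by_cases hI : (⋂ n, A n) ∈ U
  · exact ⟨_, hI, fun _ => 0, fun n x hx _ => Set.mem_iInter.1 hx n⟩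
  have hI' : (⋂ n, A n)ᶜ ∈ U := Ultrafilter.compl_mem_iff_notMem.2 hI
  have hex : ∀ x ∈ (⋂ n, A n)ᶜ, ∃ n, x ∉ A n := by
    intro x hx
    simpa using hx
  let g : ℕ → ℕ := fun x => if h : ∃ n, x ∉ A n then Nat.find h else 0
  have hg1 : ∀ x ∈ (⋂ n, A n)ᶜ, x ∉ A (g x) := by
    intro x hx
    simp only [g, dif_pos (hex x hx)]
    exact Nat.find_spec (hex x hx)
  have hg2 : ∀ x ∈ (⋂ n, A n)ᶜ, ∀ n, x ∉ A n → g x ≤ n := by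
    intro x hx n hn
    simp only [g, dif_pos (hex x hx)]
    exact Nat.find_min' _ hn
  obtain ⟨C, hC, h⟩ := hU g
  rcases h with h | h
  · exfalso
    obtain ⟨x, hx⟩ := U.nonempty_of_mem (Filter.inter_mem hC hI')
    obtain ⟨y, hy⟩ := U.nonempty_of_mem (Filter.inter_mem (Filter.inter_mem hC hI') (hA (g x)))
    apply hg1 y hy.1.2
    rw [h y hy.1.1 x hx.1]
    exact hy.2
  · refine ⟨C ∩ (⋂ n, A n)ᶜ, Filter.inter_mem hC hI', ?_⟩
    have hfin : ∀ n, ∃ m, ∀ x ∈ C ∩ (⋂ n, A n)ᶜ, x ∉ A n → x ≤ m := by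
      intro n
      have : {x | x ∈ C ∩ (⋂ n, A n)ᶜ ∧ x ∉ A n}.Finite := by
        apply Set.Finite.of_finite_image (f := g)
        · apply (Set.finite_Iic n).subset
          rintro _ ⟨x, hx, rfl⟩
          exact hg2 x hx.1.2 n hx.2
        · intro x hx y hy hxy
          exact h hx.1.1 hy.1.1 hxy
      obtain ⟨m, hm⟩ := this.bddAbove
      exact ⟨m, fun x hx hx' => hm ⟨hx, hx'⟩⟩
    choose f hf using hfin
    refine ⟨f, fun n x hx hlt => ?_⟩
    by_contra hn
    exact absurd (hf n x hx hn) (by omega)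

theorem minF_mem (s : FIN) : minF s ∈ s.1 := Finset.min'_mem _ _
theorem maxF_mem (s : FIN) : maxF s ∈ s.1 := Finset.max'_mem _ _
theorem minF_le (s : FIN) {x : ℕ} (h : x ∈ s.1) : minF s ≤ x := Finset.min'_le _ _ h
theorem le_maxF (s : FIN) {x : ℕ} (h : x ∈ s.1) : x ≤ maxF s := Finset.le_max' _ _ h
theorem minF_le_maxF (s : FIN) : minF s ≤ maxF s := minF_le s (maxF_mem s)

theorem block_lt {X : ℕ → FIN} (hX : IsBlockFun X) {i j : ℕ} (h : i < j) :
    maxF (X i) < minF (X j) := hX i j h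

theorem block_le_min {X : ℕ → FIN} (hX : IsBlockFun X) (i : ℕ) : i ≤ minF (X i) := by
  induction i with
  | zero => omega
  | succ i ih =>
    have := block_lt hX (Nat.lt_succ_self i)
    have := minF_le_maxF (X i)
    simp only [Nat.succ_eq_add_one] at *
    omega

theorem self_mem_blocks (X : ℕ → FIN) (i : ℕ) : X i ∈ blocks X :=
  ⟨{i}, by simp, by simp⟩

def fu (s t : FIN) : FIN := ⟨s.1 ∪ t.1, s.2.mono Finset.subset_union_left⟩

theorem fu_mem_blocks {X : ℕ → FIN} {s t : FIN} (hs : s ∈ blocks X) (ht : t ∈ blocks X) :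
    fu s t ∈ blocks X := by
  obtain ⟨F, hF, hs⟩ := hs
  obtain ⟨G, hG, ht⟩ := ht
  refine ⟨F ∪ G, hF.mono Finset.subset_union_left, ?_⟩
  rw [Finset.sup_union]
  simp only [fu, hs, ht]
  rfl

/-- sup of blocks is in blocks -/
theorem blocks_trans {X Y : ℕ → FIN} {F : Finset ℕ} (hF : F.Nonempty)
    (h : ∀ i ∈ F, Y i ∈ blocks X) {s : FIN} (hs : s.1 = F.sup fun i => (Y i).1) :
    s ∈ blocks X := by
  classical
  induction hF using Finset.Nonempty.cons_induction generalizing s with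
  | singleton a =>
    have : s = Y a := Subtype.ext (by simpa using hs)
    rw [this]; exact h a (by simp)
  | cons a F ha hF ih =>
    obtain ⟨i, hi⟩ := hF
    have hne : (F.sup fun i => (Y i).1).Nonempty :=
      (Y i).2.mono (Finset.le_sup (f := fun i => (Y i).1) hi)
    have h1 : (⟨F.sup fun i => (Y i).1, hne⟩ : FIN) ∈ blocks X :=
      ih (fun i hi => h i (by simp [hi])) rfl
    have : s = fu (Y a) ⟨F.sup fun i => (Y i).1, hne⟩ := by
      apply Subtype.ext
      rw [hs, Finset.sup_cons]
      rfl
    rw [this]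
    exact fu_mem_blocks (h a (by simp)) h1

theorem mem_blocks_ends {X : ℕ → FIN} (hX : IsBlockFun X) {s : FIN} (hs : s ∈ blocks X) :
    (∃ i, minF s = minF (X i)) ∧ (∃ i, maxF s = maxF (X i)) := by
  obtain ⟨F, hF, hs⟩ := hs
  have hmem : ∀ x, x ∈ s.1 ↔ ∃ i ∈ F, x ∈ (X i).1 := by
    intro x; rw [hs]; simp [Finset.mem_sup]
  constructor
  · obtain ⟨i, hi, hx⟩ := (hmem _).1 (minF_mem s)
    refine ⟨i, le_antisymm (minF_le s ((hmem _).2 ⟨i, hi, minF_mem _⟩)) (minF_le _ hx)⟩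
  · obtain ⟨i, hi, hx⟩ := (hmem _).1 (maxF_mem s)
    refine ⟨i, le_antisymm (le_maxF _ hx) (le_maxF s ((hmem _).2 ⟨i, hi, maxF_mem _⟩))⟩

/-- set of positions in `s` followed by a big gap -/
def gapset (f : ℕ → ℕ) (s : Finset ℕ) : Finset ℕ := by
  classical
  exact s.filter fun x => (∃ y ∈ s, x < y) ∧ ∀ z ∈ s, x < z → f x < z

theorem gapset_card (f : ℕ → ℕ) (s t : FIN) (h : blt s t) :
    (f (maxF s) < minF t → (gapset f (fu s t).1).card
      = (gapset f s.1).card + (gapset f t.1).card + 1) ∧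
    (¬ f (maxF s) < minF t → (gapset f (fu s t).1).card
      = (gapset f s.1).card + (gapset f t.1).card) := by
  classical
  have hst : ∀ x ∈ s.1, ∀ y ∈ t.1, x < y := fun x hx y hy =>
    lt_of_le_of_lt (le_maxF s hx) (lt_of_lt_of_le h (minF_le t hy))
  have hd : Disjoint (gapset f s.1) (gapset f t.1) := by
    rw [Finset.disjoint_left]
    intro x hx hx'
    simp only [gapset, Finset.mem_filter] at hx hx'
    exact lt_irrefl _ (hst x hx.1 x hx'.1)
  have hfu : ∀ x, x ∈ (fu s t).1 ↔ x ∈ s.1 ∨ x ∈ t.1 := by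
    intro x; simp [fu]
  have key : ∀ x, x ∈ gapset f (fu s t).1 ↔
      (x ∈ gapset f s.1 ∨ x ∈ gapset f t.1) ∨ (x = maxF s ∧ f (maxF s) < minF t) := by
    intro x
    simp only [gapset, Finset.mem_filter, hfu]
    constructor
    · rintro ⟨hx | hx, ⟨y, hy, hxy⟩, hz⟩
      · by_cases hm : x = maxF s
        · right
          refine ⟨hm, ?_⟩
          rw [← hm]
          exact hz _ (Or.inr (minF_mem t)) (hst x hx _ (minF_mem t))
        · left; left
          exact ⟨hx, ⟨maxF s, maxF_mem s, lt_of_le_of_ne (le_maxF s hx) hm⟩,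
            fun z hz' => hz z (Or.inl hz')⟩
      · left; right
        refine ⟨hx, ⟨y, ?_, hxy⟩, fun z hz' => hz z (Or.inr hz')⟩
        rcases hy with hy | hy
        · exact absurd (hst y hy x hx) (by omega)
        · exact hy
    · rintro ((⟨hx, ⟨y, hy, hxy⟩, hz⟩ | ⟨hx, ⟨y, hy, hxy⟩, hz⟩) | ⟨rfl, hlt⟩)
      · refine ⟨Or.inl hx, ⟨y, Or.inl hy, hxy⟩, ?_⟩
        rintro z (hz' | hz') hlt
        · exact hz z hz' hlt
        · exact (hz y hy hxy).trans (hst y hy z hz')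
      · refine ⟨Or.inr hx, ⟨y, Or.inr hy, hxy⟩, ?_⟩
        rintro z (hz' | hz') hlt
        · exact absurd (hst z hz' x hx) (by omega)
        · exact hz z hz' hlt
      · refine ⟨Or.inl (maxF_mem s), ⟨minF t, Or.inr (minF_mem t), h⟩, ?_⟩
        rintro z (hz' | hz') hlt'
        · exact absurd (le_maxF s hz') (by omega)
        · exact lt_of_lt_of_le hlt (minF_le t hz')
  constructor
  · intro hlt
    have he : gapset f (fu s t).1 = insert (maxF s) (gapset f s.1 ∪ gapset f t.1) := by
      ext x
      rw [key]; simp only [Finset.mem_insert, Finset.mem_union, hlt, and_true]; tauto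
    rw [he, Finset.card_insert_of_notMem, Finset.card_union_of_disjoint hd]
    simp only [Finset.mem_union, gapset, Finset.mem_filter, not_or]
    constructor
    · rintro ⟨_, ⟨y, hy, hlt⟩, _⟩
      exact absurd (le_maxF s hy) (by omega)
    · rintro ⟨hx, _⟩
      exact lt_irrefl _ (hst _ (maxF_mem s) _ hx)
  · intro hlt
    have he : gapset f (fu s t).1 = gapset f s.1 ∪ gapset f t.1 := by
      ext x
      rw [key]; simp only [Finset.mem_union, hlt, and_false, or_false]
    rw [he, Finset.card_union_of_disjoint hd]

theorem gap_refine {H : Ultrafilter FIN} (hH : IsOrderedUnion H) (f : ℕ → ℕ) (A : Set FIN)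
    (hA : A ∈ H) : ∃ X, IsBlockFun X ∧ blocks X ∈ H ∧ blocks X ⊆ A ∧
      ∀ s ∈ blocks X, ∀ t ∈ blocks X, blt s t → f (maxF s) < minF t := by
  rcases H.em (fun s => Even (gapset f s.1).card) with h | h
  · exfalso
    obtain ⟨X, hX, _, hs⟩ := hH _ h
    set j := f (maxF (X 0)) + 1
    have h1 : f (maxF (X 0)) < minF (X j) :=
      lt_of_lt_of_le (Nat.lt_succ_self _) (block_le_min hX j)
    have h2 := (gapset_card f (X 0) (X j) (hX 0 j (Nat.succ_pos _))).1 h1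
    have e0 := hs (self_mem_blocks X 0)
    have e1 := hs (self_mem_blocks X j)
    have e2 := hs (fu_mem_blocks (self_mem_blocks X 0) (self_mem_blocks X j))
    simp only [Set.mem_setOf_eq] at e0 e1 e2
    rw [h2] at e2
    grind
  · obtain ⟨X, hX, hXH, hs⟩ := hH _ (Filter.inter_mem hA h)
    refine ⟨X, hX, hXH, fun s hs' => (hs hs').1, ?_⟩
    intro s hs' t ht hst
    by_contra hlt
    have h2 := (gapset_card f s t hst).2 hlt
    have e0 := (hs hs').2
    have e1 := (hs ht).2
    have e2 := (hs (fu_mem_blocks hs' ht)).2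
    simp only [Set.mem_setOf_eq] at e0 e1 e2
    rw [h2] at e2
    grind

/-- p-point-like form of stability. -/
theorem stable_refine {H : Ultrafilter FIN} (hH : IsStableOU H) (B : ℕ → Set FIN)
    (hB : ∀ n, B n ∈ H) : ∃ C ∈ H, ∃ f : ℕ → ℕ, ∀ n, ∀ s ∈ C, f n < minF s → s ∈ B n := by
  choose X hX hXH hXB using fun n => hH.1 (B n) (hB n)
  obtain ⟨Y, hY, hYH, hev⟩ := hH.2 X (fun n => ⟨hX n, hXH n⟩)
  choose N hN using fun n => Filter.eventually_atTop.1 (hev n)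
  refine ⟨blocks Y, hYH, fun n => minF (Y (N n)), ?_⟩
  intro n s hs hlt
  apply hXB n
  obtain ⟨F, hF, hs⟩ := hs
  refine blocks_trans hF (fun i hi => hN n i ?_) hs
  by_contra hc
  have h1 := block_lt hY (not_le.1 hc)
  have h2 : minF s ≤ minF (Y i) := by
    apply minF_le
    rw [hs]
    exact Finset.le_sup (f := fun i => (Y i).1) hi (minF_mem _)
  have := minF_le_maxF (Y i)
  simp only at hlt
  omega

theorem avoid {U : Ultrafilter ℕ} {H : Ultrafilter FIN}
    (hH : IsStableOU H) (hC1 : MemC1 H U) (μ : FIN → ℕ)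
    (hμ : μ = minF ∨ μ = maxF) (p : ℕ → ℕ) (hp : Monotone p)
    (hfin : ∀ n, {x | p x = n}.Finite) (f : ℕ → ℕ) (hf : ∀ x y, f x < y → p x < p y) (j : ℕ) :
    ∃ A ∈ U, ∃ B ∈ H, ∀ x ∈ A, ∀ s ∈ B, p (μ s) + j ≠ p x + 1 := by
  have hμI : ∀ s, minF s ≤ μ s ∧ μ s ≤ maxF s := by
    intro s
    rcases hμ with rfl | rfl
    · exact ⟨le_rfl, minF_le_maxF s⟩
    · exact ⟨minF_le_maxF s, le_rfl⟩
  have hμB : ∀ X, IsBlockFun X → ∀ s ∈ blocks X, ∃ i, μ s = μ (X i) := by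
    intro X hX s hs
    rcases hμ with rfl | rfl
    · exact (mem_blocks_ends hX hs).1
    · exact (mem_blocks_ends hX hs).2
  set V := Ultrafilter.map μ H with hV
  have hne : Ultrafilter.map (fun x => p x + j) V ≠ Ultrafilter.map (fun x => p x + 1) U := by
    intro heq
    obtain ⟨A, hA, hinj⟩ := injOn_of_finite hC1.1 (fun x => p x + 1) (by
      intro n
      apply (hfin (n - 1)).subset
      intro x hx
      simp only [Set.mem_setOf_eq] at *
      omega)
    obtain ⟨g, hg⟩ := uf_map_inv U _ A hA hinj
    obtain ⟨X, hX, hXH, -, hgap⟩ := gap_refine hH.1 f Set.univ Filter.univ_mem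
    have hmono : ∀ i i', i < i' → p (μ (X i)) < p (μ (X i')) := by
      intro i i' h
      have h1 := hgap _ (self_mem_blocks X i) _ (self_mem_blocks X i') (hX _ _ h)
      exact lt_of_le_of_lt (hp (hμI _).2) (lt_of_lt_of_le (hf _ _ h1) (hp (hμI _).1))
    have hinj2 : Set.InjOn (fun x => p x + j) (Set.range fun i => μ (X i)) := by
      rintro _ ⟨i, rfl⟩ _ ⟨i', rfl⟩ he
      simp only at he
      rcases lt_trichotomy i i' with h | h | h
      · have := hmono _ _ h; omega
      · rw [h]
      · have := hmono _ _ h; omega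
    have hmem : (Set.range fun i => μ (X i)) ∈ V := by
      rw [hV, Ultrafilter.mem_map]
      refine Filter.mem_of_superset hXH ?_
      intro s hs
      obtain ⟨i, hi⟩ := hμB X hX s hs
      exact ⟨i, hi.symm⟩
    obtain ⟨g', hg'⟩ := uf_map_inv V _ _ hmem hinj2
    have hVU : RKle V U := by
      refine ⟨g' ∘ (fun x => p x + 1), ?_⟩
      rw [← Ultrafilter.map_map, ← heq, hg']
    have hUV : RKle U V := by
      refine ⟨g ∘ (fun x => p x + j), ?_⟩
      rw [← Ultrafilter.map_map, heq, hg]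
    have hVsel : IsSelective V := by
      obtain ⟨g, hg⟩ := hVU
      rw [← hg]; exact isSelective_map hC1.1 g
    have hn0 : ¬ MemC0 H V := by
      intro h0
      obtain ⟨Y, hY, hYH, -, hN⟩ := h0.2 X hX hXH
      apply hN
      rw [hV, Ultrafilter.mem_map]
      refine Filter.mem_of_superset hYH ?_
      intro s hs
      obtain ⟨i, hi⟩ := hμB Y hY s hs
      simp only [Set.mem_preimage, Nset, Set.mem_iUnion]
      exact ⟨i, by rw [hi]; exact hμI _⟩
    exact hC1.2 V hVsel hn0 ⟨hUV, hVU⟩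
  have hex : ∃ P, P ∈ Ultrafilter.map (fun x => p x + j) V ∧
      P ∉ Ultrafilter.map (fun x => p x + 1) U := by
    by_contra hc
    push Not at hc
    apply hne
    symm
    apply Ultrafilter.coe_le_coe.1
    intro P hP
    exact hc P hP
  obtain ⟨P, hP, hP'⟩ := hex
  rw [← Ultrafilter.compl_mem_iff_notMem] at hP'
  refine ⟨_, Ultrafilter.mem_map.1 hP', _, Ultrafilter.mem_map.1 (Ultrafilter.mem_map.1 hP), ?_⟩
  intro x hx s hs he
  apply hx
  simp only [Set.mem_preimage] at hs
  rw [he] at hs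
  exact hs

def kseq (f : ℕ → ℕ) : ℕ → ℕ
  | 0 => 0
  | n + 1 => kseq f n + f (kseq f n) + 1

theorem kseq_strictMono (f : ℕ → ℕ) : StrictMono (kseq f) :=
  strictMono_nat_of_lt_succ fun n => by simp only [kseq]; omega

theorem kseq_f (f : ℕ → ℕ) (n : ℕ) : f (kseq f n) < kseq f (n + 1) := by
  simp only [kseq]; omega

def pind (f : ℕ → ℕ) (x : ℕ) : ℕ := Nat.findGreatest (fun n => kseq f n ≤ x) x

theorem pind_le (f : ℕ → ℕ) (x : ℕ) : kseq f (pind f x) ≤ x :=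
  Nat.findGreatest_spec (P := fun n => kseq f n ≤ x) (Nat.zero_le x) (Nat.zero_le x)

theorem le_pind (f : ℕ → ℕ) (x n : ℕ) (h : kseq f n ≤ x) : n ≤ pind f x :=
  Nat.le_findGreatest (((kseq_strictMono f).le_apply).trans h) h

theorem lt_pind (f : ℕ → ℕ) (x : ℕ) : x < kseq f (pind f x + 1) := by
  by_contra hc
  have := le_pind f x _ (not_lt.1 hc)
  omega

/-- The combinatorial core. -/
theorem core {U : Ultrafilter ℕ} {H : Ultrafilter FIN}
    (hH : IsStableOU H) (hC1 : MemC1 H U) (f : ℕ → ℕ) (hf : Monotone f)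
    (C : Set FIN) (hC : C ∈ H) :
    ∃ A ∈ U, ∃ Y, IsBlockFun Y ∧ blocks Y ∈ H ∧ (∀ i, Y i ∈ C) ∧
      (∀ i j, i < j → f (maxF (Y i)) < minF (Y j)) ∧
      ∀ x ∈ A, ∀ i, f (maxF (Y i)) < x ∨ f x < minF (Y i) := by
  set p := pind f with hpdef
  set k := kseq f with hk
  have hp : Monotone p := by
    intro x y hxy
    exact le_pind f y _ ((pind_le f x).trans hxy)
  have hfin : ∀ n, {x | p x = n}.Finite := by
    intro n
    apply (Set.finite_Iio (k (n + 1))).subset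
    rintro x rfl
    exact lt_pind f x
  have hpf : ∀ x y, k (p x + 1) < y → p x < p y := by
    intro x y h
    have := le_pind f y _ h.le
    exact this
  have av := fun μ hμ j => avoid hH hC1 μ hμ p hp hfin (fun x => k (p x + 1)) hpf j
  choose Am hAm Bm hBm hm using fun j => av minF (Or.inl rfl) j
  choose Ax hAx Bx hBx hx using fun j => av maxF (Or.inr rfl) j
  have hCC : C ∩ (Bm 0 ∩ Bm 1 ∩ Bm 2) ∩ (Bx 0 ∩ Bx 1 ∩ Bx 2) ∈ H := by
    refine Filter.inter_mem (Filter.inter_mem hC ?_) ?_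
    · exact Filter.inter_mem (Filter.inter_mem (hBm _) (hBm _)) (hBm _)
    · exact Filter.inter_mem (Filter.inter_mem (hBx _) (hBx _)) (hBx _)
  obtain ⟨X, hX, hXH, hXC, hgap⟩ := gap_refine hH.1 f _ hCC
  obtain ⟨A0, hA0, hinj⟩ := injOn_of_finite hC1.1 (fun x => k (p x)) (by
    intro n
    by_cases hn : ∃ y, k (p y) = n
    · obtain ⟨y, rfl⟩ := hn
      apply (hfin (p y)).subset
      intro x hx
      exact (kseq_strictMono f).injective hx
    · convert Set.finite_empty
      ext x; simp only [Set.mem_setOf_eq, Set.mem_empty_iff_false, iff_false]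
      exact fun h => hn ⟨x, h⟩)
  set V := Ultrafilter.map (fun x => k (p x)) U with hV
  have hV0 : MemC0 H V := by
    by_contra h0
    obtain ⟨g, hg⟩ := uf_map_inv U _ A0 hA0 hinj
    exact hC1.2 V (isSelective_map hC1.1 _) h0 ⟨⟨g, hg⟩, ⟨_, rfl⟩⟩
  obtain ⟨Y, hY, hYH, hYX, hN⟩ := hV0.2 X hX hXH
  rw [← Ultrafilter.compl_mem_iff_notMem, hV, Ultrafilter.mem_map] at hN
  refine ⟨_, Filter.inter_mem hN (Filter.inter_mem
    (Filter.inter_mem (Filter.inter_mem (hAm 0) (hAm 1)) (hAm 2))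
    (Filter.inter_mem (Filter.inter_mem (hAx 0) (hAx 1)) (hAx 2))), Y, hY, hYH, ?_, ?_, ?_⟩
  · intro i
    exact (hXC (hYX (self_mem_blocks Y i))).1.1
  · intro i j hij
    exact hgap _ (hYX (self_mem_blocks Y i)) _ (hYX (self_mem_blocks Y j)) (hY i j hij)
  · rintro x ⟨hx0, ⟨⟨ha0, ha1⟩, ha2⟩, ⟨⟨hb0, hb1⟩, hb2⟩⟩ i
    obtain ⟨⟨_, ⟨⟨hc0, hc1⟩, hc2⟩⟩, ⟨⟨hd0, hd1⟩, hd2⟩⟩ := hXC (hYX (self_mem_blocks Y i))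
    have e0 := hm 0 x ha0 _ hc0
    have e1 := hm 1 x ha1 _ hc1
    have e2 := hm 2 x ha2 _ hc2
    have g0 := hx 0 x hb0 _ hd0
    have g1 := hx 1 x hb1 _ hd1
    have g2 := hx 2 x hb2 _ hd2
    by_cases c1 : p (maxF (Y i)) + 2 ≤ p x
    · left
      have h1 : maxF (Y i) ≤ k (p (maxF (Y i)) + 1) := (lt_pind f _).le
      calc f (maxF (Y i)) ≤ f (k (p (maxF (Y i)) + 1)) := hf h1
        _ < k (p (maxF (Y i)) + 1 + 1) := kseq_f f _
        _ ≤ k (p x) := (kseq_strictMono f).monotone c1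
        _ ≤ x := pind_le f x
    by_cases c2 : p x + 2 ≤ p (minF (Y i))
    · right
      have h1 : x ≤ k (p x + 1) := (lt_pind f _).le
      calc f x ≤ f (k (p x + 1)) := hf h1
        _ < k (p x + 1 + 1) := kseq_f f _
        _ ≤ k (p (minF (Y i))) := (kseq_strictMono f).monotone c2
        _ ≤ _ := pind_le f _
    exfalso
    apply hx0
    simp only [Nset, Set.mem_iUnion]
    refine ⟨i, ?_, ?_⟩
    · have : p (minF (Y i)) + 1 ≤ p x := by omega
      exact ((lt_pind f _).le).trans ((kseq_strictMono f).monotone this)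
    · have : p x ≤ p (maxF (Y i)) := by omega
      exact ((kseq_strictMono f).monotone this).trans (pind_le f _)

/-- even nodes built from data bounded by `n` or dummy moves -/
def Dset (T : Set (List (ℕ ⊕ FIN))) (dum : List (ℕ ⊕ FIN) → ℕ) (n : ℕ) :
    ℕ → Set (List (ℕ ⊕ FIN))
  | 0 => {[]}
  | l + 1 => {τ | τ ∈ T ∧ ∃ σ ∈ Dset T dum n l, ∃ x s, (x ≤ n ∨ x = dum σ) ∧ maxF s ≤ n ∧
      τ = σ ++ [Sum.inl x] ++ [Sum.inr s]}

theorem Dset_mono (T : Set (List (ℕ ⊕ FIN))) (dum : List (ℕ ⊕ FIN) → ℕ) {n m : ℕ} (h : n ≤ m)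
    (l : ℕ) : Dset T dum n l ⊆ Dset T dum m l := by
  induction l with
  | zero => exact subset_rfl
  | succ l ih =>
    rintro τ ⟨hT, σ, hσ, x, s, hx, hs, he⟩
    exact ⟨hT, σ, ih hσ, x, s, hx.imp (fun h' => h'.trans h) id, hs.trans h, he⟩

theorem finite_maxF (n : ℕ) : {s : FIN | maxF s ≤ n}.Finite := by
  apply Set.Finite.of_finite_image (f := Subtype.val)
  · apply (Finset.finite_toSet (Finset.powerset (Finset.range (n + 1)))).subset
    rintro _ ⟨s, hs, rfl⟩
    simp only [Finset.coe_powerset, Set.mem_preimage, Set.mem_powerset_iff]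
    intro x hx
    have := le_maxF s hx
    simp only [Set.mem_setOf_eq] at hs
    simp only [Finset.coe_range, Set.mem_Iio]
    omega
  · exact Subtype.val_injective.injOn

theorem finite_xs (n m : ℕ) : {x | x ≤ n ∨ x = m}.Finite := by
  apply (Set.finite_Iic (max n m)).subset
  intro x hx
  simp only [Set.mem_setOf_eq, Set.mem_Iic] at *
  omega

theorem Dset_finite (T : Set (List (ℕ ⊕ FIN))) (dum : List (ℕ ⊕ FIN) → ℕ) (n l : ℕ) :
    (Dset T dum n l).Finite := by
  induction l with
  | zero => exact Set.finite_singleton _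
  | succ l ih =>
    have : (⋃ σ ∈ Dset T dum n l, ⋃ x ∈ {x | x ≤ n ∨ x = dum σ},
        (fun s : FIN => σ ++ [Sum.inl x] ++ [Sum.inr s]) '' {s | maxF s ≤ n}).Finite :=
      ih.biUnion fun σ _ => (finite_xs _ _).biUnion fun x _ => (finite_maxF n).image _
    apply this.subset
    rintro τ ⟨hT, σ, hσ, x, s, hx, hs, he⟩
    simp only [Set.mem_iUnion]
    exact ⟨σ, hσ, x, hx, s, hs, he.symm⟩

theorem Dset_len {T : Set (List (ℕ ⊕ FIN))} (hnil : [] ∈ T) (dum : List (ℕ ⊕ FIN) → ℕ) (n l : ℕ) :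
    ∀ σ ∈ Dset T dum n l, σ ∈ T ∧ σ.length = 2 * l := by
  induction l with
  | zero => rintro σ rfl; exact ⟨hnil, rfl⟩
  | succ l ih =>
    rintro τ ⟨hT, σ, hσ, x, s, hx, hs, rfl⟩
    refine ⟨hT, ?_⟩
    have := (ih σ hσ).2
    simp only [List.length_append, List.length_cons, List.length_nil]
    omega

def sigSeq (c : ℕ → List (ℕ ⊕ FIN) → ℕ) (b : ℕ → FIN) : ℕ → List (ℕ ⊕ FIN)
  | 0 => []
  | n + 1 => sigSeq c b n ++ [Sum.inl (c n (sigSeq c b n))] ++ [Sum.inr (b n)]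

theorem initSeg_sig (c : ℕ → List (ℕ ⊕ FIN) → ℕ) (b : ℕ → FIN) (n : ℕ) :
    initSeg (interleave (fun i => c i (sigSeq c b i)) b) (2 * n) = sigSeq c b n := by
  induction n with
  | zero => rfl
  | succ n ih =>
    have h2 : (2 * n + 1) / 2 = n := by omega
    simp only [initSeg, Nat.mul_add, Nat.mul_one, List.range_succ, List.map_append, sigSeq] at *
    rw [ih]
    simp [interleave, h2]

/-- every `(𝒰,ℋ)`-tree has a branch `G` with
`{G(2i) : i} ∈ 𝒰`, the odd part a block sequence, and `[{G(2i+1) : i}] ∈ ℋ`,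
provided `𝒰 ∈ 𝒞₁(ℋ)`. -/
theorem stmt4 (U : Ultrafilter ℕ) (H : Ultrafilter FIN)
    (hU : IsSelective U) (hH : IsStableOU H) (hC1 : MemC1 H U)
    (T : Set (List (ℕ ⊕ FIN)))
    (hsub : ∀ g ∈ T, ∀ n, g.take n ∈ T)
    (hnil : ([] : List (ℕ ⊕ FIN)) ∈ T)
    (heven : ∀ σ ∈ T, σ.length % 2 = 0 → {n : ℕ | σ ++ [Sum.inl n] ∈ T} ∈ U)
    (hodd : ∀ σ ∈ T, σ.length % 2 = 1 → {s : FIN | σ ++ [Sum.inr s] ∈ T} ∈ H) :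
    ∃ (a : ℕ → ℕ) (b : ℕ → FIN),
      (∀ n, initSeg (interleave a b) n ∈ T) ∧
      Set.range a ∈ U ∧ IsBlockFun b ∧ blocks b ∈ H := by
  classical
  have hdum : ∀ σ : List (ℕ ⊕ FIN), ∃ d : ℕ, σ ∈ T → σ.length % 2 = 0 →
      σ ++ [Sum.inl d] ∈ T := by
    intro σ
    by_cases h : σ ∈ T ∧ σ.length % 2 = 0
    · obtain ⟨d, hd⟩ := U.nonempty_of_mem (heven σ h.1 h.2)
      exact ⟨d, fun _ _ => hd⟩
    · exact ⟨0, fun h1 h2 => absurd ⟨h1, h2⟩ h⟩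
  choose dum hdum using hdum
  let E : ℕ → Set (List (ℕ ⊕ FIN)) := fun n => ⋃ l ∈ Set.Iic (n + 1), Dset T dum n l
  have hEfin : ∀ n, (E n).Finite := fun n =>
    (Set.finite_Iic (n + 1)).biUnion fun l _ => Dset_finite T dum n l
  have hET : ∀ n, ∀ σ ∈ E n, σ ∈ T ∧ σ.length % 2 = 0 := by
    intro n σ hσ
    simp only [E, Set.mem_iUnion] at hσ
    obtain ⟨l, _, hl⟩ := hσ
    have := Dset_len hnil dum n l σ hl
    exact ⟨this.1, by omega⟩
  let A : ℕ → Set ℕ := fun n => ⋂ σ ∈ E n, {x | σ ++ [Sum.inl x] ∈ T}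
  let B : ℕ → Set FIN := fun n => ⋂ σ ∈ E n, ⋂ x ∈ {x | x ≤ n ∨ x = dum σ},
    {s | σ ++ [Sum.inl x] ∈ T → σ ++ [Sum.inl x] ++ [Sum.inr s] ∈ T}
  have hA : ∀ n, A n ∈ U := fun n =>
    (Filter.biInter_mem (hEfin n)).2 fun σ hσ => heven σ (hET n σ hσ).1 (hET n σ hσ).2
  have hB : ∀ n, B n ∈ H := fun n =>
    (Filter.biInter_mem (hEfin n)).2 fun σ hσ => (Filter.biInter_mem (finite_xs _ _)).2 fun x _ => by
      by_cases h : σ ++ [Sum.inl x] ∈ T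
      · refine Filter.mem_of_superset (hodd _ h ?_) fun s hs _ => hs
        have := (hET n σ hσ).2
        simp only [List.length_append, List.length_cons, List.length_nil]
        omega
      · exact Filter.mem_of_superset Filter.univ_mem fun s _ h' => absurd h' h
  obtain ⟨A1, hA1, f1, hf1⟩ := ppoint hU A hA
  obtain ⟨C, hC, f2, hf2⟩ := stable_refine hH B hB
  let f : ℕ → ℕ := fun n => n + ∑ m ∈ Finset.range (n + 1), (f1 m + f2 m)
  have hfm : Monotone f := by
    intro a b hab
    have : ∑ m ∈ Finset.range (a + 1), (f1 m + f2 m) ≤ ∑ m ∈ Finset.range (b + 1), (f1 m + f2 m) :=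
      Finset.sum_le_sum_of_subset (Finset.range_mono (by omega))
    simp only [f]; omega
  have hfle : ∀ n, n ≤ f n ∧ f1 n ≤ f n ∧ f2 n ≤ f n := by
    intro n
    simp only [f, Finset.sum_range_succ]
    omega
  obtain ⟨A2, hA2, Y, hY, hYH, hYC, hYgap, hAY⟩ :=
    core hH hC1 f hfm (C ∩ B 0) (Filter.inter_mem hC (hB 0))
  have hmaxY : ∀ i, i ≤ maxF (Y i) := fun i => (block_le_min hY i).trans (minF_le_maxF _)
  have hγex : ∀ x, ∃ i, x ≤ maxF (Y i) := fun x => ⟨x, hmaxY x⟩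
  let γ : ℕ → ℕ := fun x => Nat.find (hγex x)
  have hγ1 : ∀ x, x ≤ maxF (Y (γ x)) := fun x => Nat.find_spec (hγex x)
  have hγ2 : ∀ x i, i < γ x → maxF (Y i) < x := fun x i hi =>
    not_le.1 (Nat.find_min (hγex x) hi)
  obtain ⟨A3, hA3, hinj⟩ := injOn_of_finite hU γ (by
    intro n
    apply (Set.finite_Iic (maxF (Y n))).subset
    rintro x rfl
    exact hγ1 x)
  let A4 : Set ℕ := A1 ∩ A 0 ∩ A2 ∩ A3
  have hA4 : A4 ∈ U := Filter.inter_mem (Filter.inter_mem (Filter.inter_mem hA1 (hA 0)) hA2) hA3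
  have hright : ∀ x ∈ A4, f x < minF (Y (γ x)) := by
    intro x hx
    rcases hAY x hx.1.2 (γ x) with h | h
    · have h1 := hγ1 x
      have := (hfle (maxF (Y (γ x)))).1
      omega
    · exact h
  have hleft : ∀ x ∈ A4, ∀ i, i < γ x → f (maxF (Y i)) < x := by
    intro x hx i hi
    rcases hAY x hx.1.2 i with h | h
    · exact h
    · have h1 := hγ2 x i hi
      have h2 := minF_le_maxF (Y i)
      have := (hfle x).1
      omega
  let c : ℕ → List (ℕ ⊕ FIN) → ℕ := fun i σ =>
    if h : ∃ x, x ∈ A4 ∧ γ x = i then h.choose else dum σ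
  let bd : ℕ → ℕ := fun i => if i = 0 then 0 else maxF (Y (i - 1))
  have hbd : ∀ i, i ≤ bd i + 1 := by
    intro i
    rcases i with _ | i
    · omega
    · have := hmaxY i
      simp only [bd, Nat.add_sub_cancel]; simp; omega
  have hbdY : ∀ i, bd i ≤ maxF (Y i) := by
    intro i
    rcases i with _ | i
    · simp [bd]
    · have := block_lt hY (Nat.lt_succ_self i)
      have := minF_le_maxF (Y (i + 1))
      simp [bd]; simp at *; omega
  have hDE : ∀ n i, bd i ≤ n → ∀ σ ∈ Dset T dum (bd i) i, σ ∈ E n := by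
    intro n i hn σ hσ
    simp only [E, Set.mem_iUnion]
    have := hbd i
    exact ⟨i, by simp only [Set.mem_Iic]; omega, Dset_mono T dum hn i hσ⟩
  have hBuse : ∀ n s σ x, s ∈ B n → σ ∈ E n → (x ≤ n ∨ x = dum σ) →
      σ ++ [Sum.inl x] ∈ T → σ ++ [Sum.inl x] ++ [Sum.inr s] ∈ T := by
    intro n s σ x hs hσ hx hT
    simp only [B, Set.mem_iInter] at hs
    exact hs σ hσ x hx hT
  have hAuse : ∀ n x σ, x ∈ A n → σ ∈ E n → σ ++ [Sum.inl x] ∈ T := by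
    intro n x σ hx hσ
    simp only [A, Set.mem_iInter] at hx
    exact hx σ hσ
  have main : ∀ i, sigSeq c Y i ∈ Dset T dum (bd i) i := by
    intro i
    induction i with
    | zero => rfl
    | succ i ih =>
      have hb1 : bd (i + 1) = maxF (Y i) := by simp [bd]
      rw [hb1]
      have hD := Dset_mono T dum (hbdY i) i ih
      have hEi := hDE (bd i) i le_rfl _ ih
      by_cases h : ∃ x, x ∈ A4 ∧ γ x = i
      · have hc : c i (sigSeq c Y i) = h.choose := dif_pos h
        obtain ⟨hx4, hxi⟩ := h.choose_spec
        set x := h.choose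
        have hr := hright x hx4
        rw [hxi] at hr
        have hfx := hfle x
        have hmm := minF_le_maxF (Y i)
        have hbx : bd i ≤ x ∧ x ∈ A (bd i) := by
          rcases Nat.eq_zero_or_pos i with h0 | h0
          · have : bd i = 0 := by simp [bd, h0]
            rw [this]; exact ⟨Nat.zero_le _, hx4.1.1.2⟩
          · have h1 : bd i = maxF (Y (i - 1)) := by simp [bd]; omega
            have h2 := hleft x hx4 (i - 1) (by omega)
            rw [← h1] at h2
            have h3 := hfle (bd i)
            exact ⟨by omega, hf1 _ x hx4.1.1.1 (by omega)⟩
        have hT1 := hAuse _ x _ hbx.2 hEi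
        have hBx : Y i ∈ B x := hf2 x _ (hYC i).1 (by omega)
        have hT2 := hBuse x _ _ x hBx (hDE x i hbx.1 _ ih) (Or.inl le_rfl) hT1
        simp only [sigSeq, hc]
        exact ⟨hT2, _, hD, x, Y i, Or.inl (by omega), le_rfl, rfl⟩
      · have hc : c i (sigSeq c Y i) = dum (sigSeq c Y i) := dif_neg h
        have hT1 := hdum _ (hET _ _ hEi).1 (hET _ _ hEi).2
        have hBx : Y i ∈ B (bd i) := by
          rcases Nat.eq_zero_or_pos i with h0 | h0
          · have : bd i = 0 := by simp [bd, h0]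
            rw [this]; exact (hYC i).2
          · have h1 : bd i = maxF (Y (i - 1)) := by simp [bd]; omega
            have h2 := hYgap (i - 1) i (by omega)
            rw [← h1] at h2
            have h3 := hfle (bd i)
            exact hf2 _ _ (hYC i).1 (by omega)
        have hT2 := hBuse _ _ _ _ hBx hEi (Or.inr rfl) hT1
        simp only [sigSeq, hc]
        exact ⟨hT2, _, hD, _, Y i, Or.inr rfl, le_rfl, rfl⟩
  refine ⟨fun i => c i (sigSeq c Y i), Y, ?_, ?_, hY, hYH⟩
  · intro n
    have h1 : initSeg (interleave (fun i => c i (sigSeq c Y i)) Y) (2 * n) ∈ T := by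
      rw [initSeg_sig]
      exact (Dset_len hnil dum _ _ _ (main n)).1
    have h2 := hsub _ h1 n
    have h3 : (initSeg (interleave (fun i => c i (sigSeq c Y i)) Y) (2 * n)).take n
        = initSeg (interleave (fun i => c i (sigSeq c Y i)) Y) n := by
      simp only [initSeg, ← List.map_take, List.take_range]
      congr 2; omega
    rw [h3] at h2
    exact h2
  · refine Filter.mem_of_superset hA4 ?_
    intro x hx
    refine ⟨γ x, ?_⟩
    have h : ∃ y, y ∈ A4 ∧ γ y = γ x := ⟨x, hx, rfl⟩
    have hc : c (γ x) (sigSeq c Y (γ x)) = h.choose := dif_pos h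
    simp only [hc]
    exact hinj h.choose_spec.1.2 hx.2 h.choose_spec.2
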